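/- For all natural numbers n and i with n ≥ i, the sum over k from 0 to n of k^i · C(n, k) · d(n-k) equals B_i · n!, where B_i is the i-th Bell number. Equivalently, the i-th moment of the number of fixed points of a uniformly random permutation of an n-element set equals the i-th Bell number whenever n ≥ i. -/

import Mathlib

/-- The `i`-th Bell number: the number of partitions of an `i`-element set into
nonempty subsets. -/
def bellNumber (i : ℕ) : ℕ :=
  Fintype.card (Finpartition (Finset.univ : Finset (Fin i)))

namespace Finpartition

variable {α : Type*} [Fintype α] [DecidableEq α]

theorem image_part_univ (P : Finpartition (Finset.univ : Finset α)) :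
    Finset.univ.image P.part = P.parts := by
  ext s
  simp only [Finset.mem_image, Finset.mem_univ, true_and]
  constructor
  · rintro ⟨a, rfl⟩
    exact P.part_mem.2 (Finset.mem_univ a)
  · intro hs
    obtain ⟨a, ha⟩ := P.nonempty_of_mem_parts hs
    exact ⟨a, P.part_eq_of_mem hs ha⟩

theorem ext_part {P Q : Finpartition (Finset.univ : Finset α)} (h : ∀ a, P.part a = Q.part a) :
    P = Q := by
  ext1
  rw [← image_part_univ, ← image_part_univ, funext h]

open Classical in
/-- Finpartitions of a finite type correspond to equivalence relations on it. -/
noncomputable def equivSetoid : Finpartition (Finset.univ : Finset α) ≃ Setoid α where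
  toFun P := Setoid.ker P.part
  invFun s := ofSetoid s
  left_inv P := by
    refine ext_part fun a => ?_
    ext b
    rw [mem_part_ofSetoid_iff_rel, Setoid.ker_def, eq_comm,
      ← P.mem_part_iff_part_eq_part (Finset.mem_univ b) (Finset.mem_univ a)]
  right_inv s := by
    ext a b
    rw [Setoid.ker_def,
      ← mem_part_iff_part_eq_part _ (Finset.mem_univ a) (Finset.mem_univ b),
      mem_part_ofSetoid_iff_rel]
    exact s.comm'

end Finpartition

namespace Equiv.Perm

open MulAction Function

variable {α β : Type*}

theorem orbitRel_fun_iff_ker_eq [Finite β] {f g : α → β} :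
    orbitRel (Perm β) (α → β) f g ↔ Setoid.ker f = Setoid.ker g := by
  rw [orbitRel_apply]
  constructor
  · rintro ⟨σ, rfl⟩
    ext a b
    simp [Setoid.ker_def]
  · intro h
    have : Finite (Quotient (Setoid.ker f)) := .of_injective _ (Setoid.kerLift_injective f)
    have hg : ∀ a b, Setoid.ker f a b → g a = g b := fun a b hab => by
      rwa [h, Setoid.ker_def] at hab
    have hinj : Injective (Quotient.lift g hg : Quotient (Setoid.ker f) → β) :=
      (Setoid.lift_injective_iff_ker_eq_of_le (f := g) hg).2 h.symm
    obtain ⟨σ, hσ⟩ := Equiv.Perm.exists_extending_pair _ _ hinj (Setoid.kerLift_injective f)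
    exact ⟨σ, funext fun a => hσ (Quotient.mk _ a)⟩

/-- If `α` embeds in the finite type `β`, the orbits of `Perm β` on functions `α → β` are classified
by their kernels, and every equivalence relation on `α` occurs as a kernel. -/
noncomputable def orbitsFunEquivSetoid [Finite β] (e : α ↪ β) :
    Quotient (orbitRel (Perm β) (α → β)) ≃ Setoid α :=
  Equiv.ofBijective
    (Quotient.lift Setoid.ker fun _ _ h => orbitRel_fun_iff_ker_eq.1 h) <| by
    constructor
    · rintro ⟨f⟩ ⟨g⟩ h
      exact Quotient.sound (orbitRel_fun_iff_ker_eq.2 h)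
    · intro s
      refine ⟨Quotient.mk _ fun a => e (Quotient.mk s a).out, ?_⟩
      ext a b
      change e _ = e _ ↔ _
      rw [e.injective.eq_iff, Quotient.out_inj, Quotient.eq]

variable [Fintype α] [Fintype β] [DecidableEq α] [DecidableEq β]

theorem card_fixedBy_fun (σ : Perm β) [Fintype (fixedBy (α → β) σ)] :
    Fintype.card (fixedBy (α → β) σ) =
      Fintype.card (fixedPoints σ) ^ Fintype.card α := by
  rw [← Fintype.card_fun]
  refine Fintype.card_congr
    { toFun f a := ⟨f.1 a, congr_fun f.2 a⟩
      invFun f := ⟨fun a => f a, funext fun a => (f a).2⟩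
      left_inv _ := rfl
      right_inv _ := rfl }

theorem card_filter_fixedPoints_eq (s : Finset β) :
    (Finset.univ.filter fun σ : Perm β => Finset.univ.filter (fun x => σ x = x) = s).card =
      numDerangements (Fintype.card β - s.card) := by
  rw [← Fintype.card_subtype, ← Finset.card_compl, ← Fintype.card_coe,
    ← card_derangements_eq_numDerangements]
  refine Fintype.card_congr (Equiv.trans (Equiv.subtypeEquivRight fun σ => ?_)
    (derangements.subtypeEquiv (· ∈ sᶜ)).symm)
  simp [Finset.ext_iff, mem_fixedPoints, IsFixedPt, iff_comm]

theorem sum_card_fixedPoints (f : ℕ → ℕ) :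
    ∑ σ : Perm β, f (Fintype.card (fixedPoints σ)) =
      ∑ k ∈ Finset.range (Fintype.card β + 1),
        (Fintype.card β).choose k * (numDerangements (Fintype.card β - k) * f k) := by
  have hcard (σ : Perm β) :
      Fintype.card (fixedPoints σ) = (Finset.univ.filter fun x => σ x = x).card :=
    Fintype.card_subtype _
  simp_rw [hcard]
  rw [← Finset.sum_fiberwise Finset.univ fun σ : Perm β => Finset.univ.filter fun x => σ x = x]
  have hfiber (s : Finset β) :
      ∑ σ : Perm β with Finset.univ.filter (fun x => σ x = x) = s,
        f (Finset.univ.filter fun x => σ x = x).card =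
      numDerangements (Fintype.card β - s.card) * f s.card := by
    rw [← card_filter_fixedPoints_eq, ← smul_eq_mul]
    refine Finset.sum_eq_card_nsmul fun σ hσ => ?_
    rw [(Finset.mem_filter.1 hσ).2]
  simp_rw [hfiber]
  rw [← Finset.powerset_univ,
    Finset.sum_powerset_apply_card fun k => numDerangements (Fintype.card β - k) * f k]
  simp

end Equiv.Perm

/-- For `n ≥ i`, `∑_{k=0}^n k^i · C(n,k) · d(n-k) = B_i · n!`, where `B_i` is the
`i`-th Bell number and `d` is the number of derangements. -/
theorem sum_pow_mul_choose_mul_numDerangements (n i : ℕ) (h : i ≤ n) :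
    ∑ k ∈ Finset.range (n + 1),
      k ^ i * n.choose k * numDerangements (n - k) = bellNumber i * n.factorial := by
  classical
  have e := (Equiv.Perm.orbitsFunEquivSetoid (Fin.castLEEmb h)).trans Finpartition.equivSetoid.symm
  have := Fintype.ofEquiv _ e.symm
  have burnside := MulAction.sum_card_fixedBy_eq_card_orbits_mul_card_group
    (Equiv.Perm (Fin n)) (Fin i → Fin n)
  simp_rw [Equiv.Perm.card_fixedBy_fun] at burnside
  rw [Equiv.Perm.sum_card_fixedPoints (· ^ Fintype.card (Fin i)), Fintype.card_congr e,
    Fintype.card_perm] at burnside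
  simp only [Fintype.card_fin] at burnside
  rw [bellNumber, ← burnside]
  exact Finset.sum_congr rfl fun k _ => by ring
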